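/- Let c and d be real numbers with c(2c − 1)(5c + 22)(7c + 68) ≠ 0. Set h = 3/2, x = 7/20, and define E₃ = 8hd((70h² + 42h + 8)c + 29h² − 57h − 2), E₂ = −12hd((14h + 4)c² + (−308h² − 93h − 1)c + 170h² + 34h), E₁ = 2hd(4c³ + (−222h − 1)c² + (3008h² + 102h)c − 1496h²), D₆ = c(5c + 22)(2c − 1)(7c + 68), T₁ = 2hdx/c, T₂ = (4hd(5h + 1)x² + 2hd(22h − c)x)/(c(5c + 22)), and T₃ = (E₃x³ + E₂x² + E₁x)/D₆. If real numbers (x₀, x₁, x₂, x₃) satisfy x₀ + x₁ + x₂ + x₃ = d, (1/10)x₁ + (3/5)x₂ + (3/2)x₃ = T₁, (1/10)²x₁ + (3/5)²x₂ + (3/2)²x₃ = T₂, and (1/10)³x₁ + (3/5)³x₂ + (3/2)³x₃ = T₃, then x₂ = −7d(2c − 47)(10c − 7)(82c − 37)/(80c(2c − 1)(5c + 22)(7c + 68)) and x₃ = d(800c³ − 27588c² + 238596c − 112133)/(80c(2c − 1)(5c + 22)(7c + 68)). -/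

import Mathlib

theorem stmt_9 (c d : ℝ) (hc : c * (2 * c - 1) * (5 * c + 22) * (7 * c + 68) ≠ 0)
    (h x : ℝ) (hh : h = 3/2) (hx : x = 7/20)
    (E3 E2 E1 D6 T1 T2 T3 : ℝ)
    (hE3 : E3 = 8 * h * d * ((70 * h ^ 2 + 42 * h + 8) * c + 29 * h ^ 2 - 57 * h - 2))
    (hE2 : E2 = -12 * h * d * ((14 * h + 4) * c ^ 2 + (-308 * h ^ 2 - 93 * h - 1) * c
      + 170 * h ^ 2 + 34 * h))
    (hE1 : E1 = 2 * h * d * (4 * c ^ 3 + (-222 * h - 1) * c ^ 2 + (3008 * h ^ 2 + 102 * h) * c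
      - 1496 * h ^ 2))
    (hD6 : D6 = c * (5 * c + 22) * (2 * c - 1) * (7 * c + 68))
    (hT1 : T1 = 2 * h * d * x / c)
    (hT2 : T2 = (4 * h * d * (5 * h + 1) * x ^ 2 + 2 * h * d * (22 * h - c) * x)
      / (c * (5 * c + 22)))
    (hT3 : T3 = (E3 * x ^ 3 + E2 * x ^ 2 + E1 * x) / D6)
    (x0 x1 x2 x3 : ℝ)
    (e0 : x0 + x1 + x2 + x3 = d)
    (e1 : (1/10) * x1 + (3/5) * x2 + (3/2) * x3 = T1)
    (e2 : (1/10) ^ 2 * x1 + (3/5) ^ 2 * x2 + (3/2) ^ 2 * x3 = T2)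
    (e3 : (1/10) ^ 3 * x1 + (3/5) ^ 3 * x2 + (3/2) ^ 3 * x3 = T3) :
    x2 = -7 * d * (2 * c - 47) * (10 * c - 7) * (82 * c - 37)
        / (80 * c * (2 * c - 1) * (5 * c + 22) * (7 * c + 68)) ∧
      x3 = d * (800 * c ^ 3 - 27588 * c ^ 2 + 238596 * c - 112133)
        / (80 * c * (2 * c - 1) * (5 * c + 22) * (7 * c + 68)) := by
  have hc₀ : c ≠ 0 := by rintro rfl; simp at hc
  have hc₁ : 2 * c - 1 ≠ 0 := by intro h0; simp [h0] at hc
  have hc₂ : 5 * c + 22 ≠ 0 := by intro h0; simp [h0] at hc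
  have hc₃ : 7 * c + 68 ≠ 0 := by intro h0; simp [h0] at hc
  -- Lagrange interpolation at the eigenvalues isolates each multiplicity.
  have hx2 : x2 = -(100 / 27) * (T3 - 8 / 5 * T2 + 3 / 20 * T1) := by
    linear_combination (-(100 / 27)) * (e3 - 8 / 5 * e2 + 3 / 20 * e1)
  have hx3 : x3 = 100 / 189 * (T3 - 7 / 10 * T2 + 3 / 50 * T1) := by
    linear_combination (100 / 189) * (e3 - 7 / 10 * e2 + 3 / 50 * e1)
  have hD : 80 * c * (2 * c - 1) * (5 * c + 22) * (7 * c + 68) ≠ 0 := by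
    simpa [mul_assoc] using hc
  have hT1' : T1 * c = 2 * h * d * x := by
    rw [hT1, div_mul_cancel₀ _ hc₀]
  have hT2' : T2 * (c * (5 * c + 22)) =
      4 * h * d * (5 * h + 1) * x ^ 2 + 2 * h * d * (22 * h - c) * x := by
    rw [hT2, div_mul_cancel₀ _ (mul_ne_zero hc₀ hc₂)]
  have hT3' : T3 * (c * (5 * c + 22) * (2 * c - 1) * (7 * c + 68)) =
      E3 * x ^ 3 + E2 * x ^ 2 + E1 * x := by
    rw [hT3, hD6, div_mul_cancel₀ _
      (mul_ne_zero (mul_ne_zero (mul_ne_zero hc₀ hc₂) hc₁) hc₃)]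
  subst hE3 hE2 hE1 hh hx
  rw [eq_div_iff hD, eq_div_iff hD, hx2, hx3]
  constructor
  · linear_combination (-(8000 / 27)) * (hT3' - 8 / 5 * (2 * c - 1) * (7 * c + 68) * hT2' +
      3 / 20 * (5 * c + 22) * (2 * c - 1) * (7 * c + 68) * hT1')
  · linear_combination (8000 / 189) * (hT3' - 7 / 10 * (2 * c - 1) * (7 * c + 68) * hT2' +
      3 / 50 * (5 * c + 22) * (2 * c - 1) * (7 * c + 68) * hT1')
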